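/- arXiv:2302.14685 — 2 statements merged into one kernel-verified Lean document; each statement's English description precedes it below -/
import Mathlib

section
/- Let q be a natural number with q ≥ 3, let ρ > 0, let σ₀ ∈ (0,1), and set T* = 2·(σ₀^(−(q−2)) − 1)/(ρ·(q−2)). If g : ℝ → ℝ is differentiable on [0,T*], g(t) > 0 on [0,T*], g(0) = σ₀, and g'(t) = (ρ/2)·g(t)^(q−1) for all t ∈ [0,T*], then g(T*) = 1. -/
/-- Along a positive solution of `g' = c * g ^ (m + 1)`, the quantity `(g ^ m)⁻¹ + m * c * t` is
conserved. -/
theorem inv_pow_add_mul_eq_of_hasDerivWithinAt {g : ℝ → ℝ} {c T : ℝ} (m : ℕ)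
    (hpos : ∀ t ∈ Set.Icc (0 : ℝ) T, 0 < g t)
    (hderiv : ∀ t ∈ Set.Icc (0 : ℝ) T,
      HasDerivWithinAt g (c * g t ^ (m + 1)) (Set.Icc (0 : ℝ) T) t)
    {t : ℝ} (ht : t ∈ Set.Icc (0 : ℝ) T) :
    (g t ^ m)⁻¹ + m * c * t = (g 0 ^ m)⁻¹ := by
  have hconst : ∀ s ∈ Set.Icc (0 : ℝ) T,
      HasDerivWithinAt (fun s => (g s ^ m)⁻¹ + m * c * s) 0 (Set.Icc (0 : ℝ) T) s := by
    intro s hs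
    have hg : g s ≠ 0 := (hpos s hs).ne'
    refine ((((hderiv s hs).fun_pow m).fun_inv (pow_ne_zero m hg)).fun_add
      ((hasDerivWithinAt_id s _).const_mul (m * c))).congr_deriv ?_
    rcases m with _ | m
    · simp
    · simp only [Nat.add_sub_cancel]
      field_simp
      ring
  have h := constant_of_derivWithin_zero (fun s hs => (hconst s hs).differentiableWithinAt)
    (fun s hs => (hconst s (Set.Ico_subset_Icc_self hs)).derivWithin
      (uniqueDiffOn_Icc (hs.1.trans_lt hs.2) s (Set.Ico_subset_Icc_self hs))) t ht
  simpa using h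

/-- Convergence time for learning a feature patch (Eq. 24 of the supplementary,
used in Proposition 1): under the dynamics `g' = (ρ/2)·g^(q−1)` with `g(0) = σ₀`,
the alignment reaches `1` at time `T* = 2·(σ₀^(−(q−2)) − 1)/(ρ·(q−2))`. -/
theorem feature_convergence_time
    (q : ℕ) (hq : 3 ≤ q) (ρ : ℝ) (hρ : 0 < ρ) (σ₀ : ℝ)
    (hσ₀ : σ₀ ∈ Set.Ioo (0 : ℝ) 1)
    (T : ℝ) (hT : T = 2 * (σ₀ ^ (-((q : ℤ) - 2)) - 1) / (ρ * ((q : ℝ) - 2)))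
    (g : ℝ → ℝ)
    (hpos : ∀ t ∈ Set.Icc (0 : ℝ) T, 0 < g t)
    (h0 : g 0 = σ₀)
    (hderiv : ∀ t ∈ Set.Icc (0 : ℝ) T,
      HasDerivWithinAt g (ρ / 2 * g t ^ (q - 1)) (Set.Icc (0 : ℝ) T) t) :
    g T = 1 := by
  obtain ⟨m, rfl⟩ : ∃ m, q = m + 2 := ⟨q - 2, by lia⟩
  have hm : m ≠ 0 := by lia
  have hexp : σ₀ ^ (-(((m + 2 : ℕ) : ℤ) - 2)) = (σ₀ ^ m)⁻¹ := by
    rw [show -(((m + 2 : ℕ) : ℤ) - 2) = -(m : ℤ) by push_cast; ring, zpow_neg, zpow_natCast]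
  have hT' : T = 2 * ((σ₀ ^ m)⁻¹ - 1) / (ρ * m) := by
    rw [hT, hexp]
    push_cast
    ring_nf
  have hle : 1 ≤ (σ₀ ^ m)⁻¹ :=
    (one_le_inv₀ (pow_pos hσ₀.1 m)).2 (pow_le_one₀ hσ₀.1.le hσ₀.2.le)
  have hT0 : 0 ≤ T := by
    rw [hT']
    exact div_nonneg (by linarith) (by positivity)
  have hTmem : T ∈ Set.Icc (0 : ℝ) T := ⟨hT0, le_rfl⟩
  have h := inv_pow_add_mul_eq_of_hasDerivWithinAt m hpos hderiv hTmem
  have hmul : m * (ρ / 2) * T = (σ₀ ^ m)⁻¹ - 1 := by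
    rw [hT']
    field_simp
  rw [h0, hmul] at h
  have hpow : g T ^ m = 1 := inv_eq_one.1 (by linarith)
  exact (pow_eq_one_iff_of_nonneg (hpos T hTmem).le hm).1 hpow
end

section
/- Let q be a natural number with q ≥ 3, let n, m, d ≥ 1 be natural numbers, let σ > 0 and T ≥ 0, and suppose σ²/(m·√d) ∈ (0,1). Set t* = 2n·((σ²/(m·√d))^(−(q−2)) − 1)/(σ²·(q−2)). If g : ℝ → ℝ is differentiable on [T, T + t*], g(t) > 0 on this interval, g(T) = σ²/(m·√d), and g'(t) = (σ²/(2n))·g(t)^(q−1) for all t ∈ [T, T + t*], then g(T + t*) = 1. Moreover (σ²/(m·√d))^(−(q−2)) = σ^(4−2q)·m^(q−2)·d^((q−2)/2), so t* = 2n·(σ^(4−2q)·m^(q−2)·d^((q−2)/2) − 1)/(σ²·(q−2)). -/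
/-- Along a positive solution of `g' = c·g^(k+2)`, the quantity `g^(-(k+1))` decreases at the
constant rate `(k+1)·c`. -/
theorem inv_pow_eq_sub_of_hasDerivWithinAt {g : ℝ → ℝ} {a b c : ℝ} (k : ℕ) (hab : a ≤ b)
    (hpos : ∀ s ∈ Set.Icc a b, 0 < g s)
    (hg : ∀ s ∈ Set.Icc a b, HasDerivWithinAt g (c * g s ^ (k + 2)) (Set.Icc a b) s) :
    (g b ^ (k + 1))⁻¹ = (g a ^ (k + 1))⁻¹ - (k + 1) * c * (b - a) := by
  have hF : ∀ s ∈ Set.Icc a b, HasDerivWithinAt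
      (fun s => (g s ^ (k + 1))⁻¹ + (k + 1) * c * s) 0 (Set.Icc a b) s := by
    intro s hs
    have h0 : g s ≠ 0 := (hpos s hs).ne'
    have h := (((hg s hs).fun_pow (k + 1)).fun_inv (pow_ne_zero _ h0)).fun_add
      ((hasDerivWithinAt_id s (Set.Icc a b)).const_mul ((k + 1) * c))
    refine h.congr_deriv ?_
    simp only [Nat.add_sub_cancel]
    push_cast
    field_simp
    ring
  have hconst := constant_of_derivWithin_zero
    (fun s hs => (hF s hs).differentiableWithinAt)
    (fun s hs => (hF s (Set.Ico_subset_Icc_self hs)).derivWithin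
      (uniqueDiffOn_Icc (hs.1.trans_lt hs.2) s (Set.Ico_subset_Icc_self hs)))
    b (Set.right_mem_Icc.mpr hab)
  linarith

/-- The reciprocal power of the averaged initial alignment, expanded into its factors. -/
theorem zpow_neg_sq_div_mul_sqrt (k : ℕ) {σ m d : ℝ} (hd : 0 ≤ d) :
    (σ ^ 2 / (m * Real.sqrt d)) ^ (-(k : ℤ)) =
      σ ^ (-(2 * k : ℤ)) * m ^ k * d ^ ((k : ℝ) / 2) := by
  have hsqrt : Real.sqrt d ^ k = d ^ ((k : ℝ) / 2) := by
    rw [Real.sqrt_eq_rpow, ← Real.rpow_natCast, ← Real.rpow_mul hd]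
    congr 1
    ring
  have hσ : σ ^ (-(2 * k : ℤ)) = ((σ ^ 2) ^ k)⁻¹ := by
    rw [zpow_neg, ← pow_mul]
    norm_cast
  rw [zpow_neg, zpow_natCast, div_pow, inv_div, mul_pow, hsqrt, hσ]
  ring

/-- Proposition 3 of the paper, made precise: after averaging the `m` models at epoch `T`,
the alignment of a weight channel with a noisy patch restarts from `σ²/(m·√d)` and evolves
as `g' = (σ²/(2n))·g^(q−1)`; it reaches `1` after an additional time
`t* = 2n·((σ²/(m·√d))^(−(q−2)) − 1)/(σ²·(q−2))`, and
`(σ²/(m·√d))^(−(q−2)) = σ^(4−2q)·m^(q−2)·d^((q−2)/2)`, so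
`t* = 2n·(σ^(4−2q)·m^(q−2)·d^((q−2)/2) − 1)/(σ²·(q−2))`. -/
theorem noise_convergence_time_after_interpolation
    (q : ℕ) (hq : 3 ≤ q) (n m d : ℕ) (hn : 1 ≤ n) (hm : 1 ≤ m) (hd : 1 ≤ d)
    (σ : ℝ) (hσ : 0 < σ) (T : ℝ) (hTnn : 0 ≤ T)
    (hinit : σ ^ 2 / (m * Real.sqrt d) ∈ Set.Ioo (0 : ℝ) 1)
    (t : ℝ)
    (ht : t = 2 * n * ((σ ^ 2 / (m * Real.sqrt d)) ^ (-((q : ℤ) - 2)) - 1) /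
      (σ ^ 2 * ((q : ℝ) - 2)))
    (g : ℝ → ℝ)
    (hpos : ∀ s ∈ Set.Icc T (T + t), 0 < g s)
    (hT0 : g T = σ ^ 2 / (m * Real.sqrt d))
    (hderiv : ∀ s ∈ Set.Icc T (T + t),
      HasDerivWithinAt g (σ ^ 2 / (2 * n) * g s ^ (q - 1)) (Set.Icc T (T + t)) s) :
    g (T + t) = 1 ∧
      (σ ^ 2 / (m * Real.sqrt d)) ^ (-((q : ℤ) - 2)) =
        σ ^ ((4 : ℤ) - 2 * q) * (m : ℝ) ^ (q - 2) * (d : ℝ) ^ (((q : ℝ) - 2) / 2) ∧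
      t = 2 * n * (σ ^ ((4 : ℤ) - 2 * q) * (m : ℝ) ^ (q - 2) * (d : ℝ) ^ (((q : ℝ) - 2) / 2) - 1) /
        (σ ^ 2 * ((q : ℝ) - 2)) := by
  obtain ⟨k, rfl⟩ := Nat.exists_eq_add_of_le' hq
  have hexp : -(((k + 3 : ℕ) : ℤ) - 2) = -((k + 1 : ℕ) : ℤ) := by push_cast; ring
  have hq2 : ((k + 3 : ℕ) : ℝ) - 2 = k + 1 := by push_cast; ring
  have hfactor : (σ ^ 2 / (m * Real.sqrt d)) ^ (-(((k + 3 : ℕ) : ℤ) - 2)) =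
      σ ^ ((4 : ℤ) - 2 * (k + 3 : ℕ)) * (m : ℝ) ^ (k + 3 - 2) *
        (d : ℝ) ^ ((((k + 3 : ℕ) : ℝ) - 2) / 2) := by
    have hσexp : (4 : ℤ) - 2 * (k + 3 : ℕ) = -(2 * (k + 1 : ℕ)) := by push_cast; ring
    rw [hexp, hq2, hσexp, zpow_neg_sq_div_mul_sqrt (k + 1) d.cast_nonneg, Nat.cast_succ (R := ℝ)]
    rfl
  refine ⟨?_, hfactor, hfactor ▸ ht⟩
  rw [hexp, hq2, zpow_neg, zpow_natCast, ← hT0] at ht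
  rw [← hT0] at hinit
  have hn0 : (0 : ℝ) < n := by exact_mod_cast hn
  have hk0 : (0 : ℝ) < k + 1 := by positivity
  have hinv : 1 ≤ (g T ^ (k + 1))⁻¹ :=
    (one_le_inv₀ (pow_pos hinit.1 _)).mpr (pow_le_one₀ hinit.1.le hinit.2.le)
  have ht0 : 0 ≤ t := by
    rw [ht]
    have := sub_nonneg.mpr hinv
    positivity
  have hdecay := inv_pow_eq_sub_of_hasDerivWithinAt k (le_add_of_nonneg_right ht0) hpos hderiv
  have hrate : (k + 1) * (σ ^ 2 / (2 * n)) * (T + t - T) = (g T ^ (k + 1))⁻¹ - 1 := by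
    rw [add_sub_cancel_left, ht]
    field_simp
  rw [hrate, sub_sub_cancel, inv_eq_one] at hdecay
  have hend := hpos (T + t) (Set.right_mem_Icc.mpr (le_add_of_nonneg_right ht0))
  exact (pow_eq_one_iff_of_nonneg hend.le k.succ_ne_zero).mp hdecay
end
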